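/- The parameters ℓ_{μν}, p_{μν} defined from α, β, γ satisfy ℓ_{μν}² + p_{μν} p_{ν'μ'} = 1 for all μ,ν ∈ {0,1,2,3}. Moreover, for each ν ∈ {0,1,2,3} the condition p_{μ_ν ν} + p_{μ̃_ν ν} + ℓ_{μ̃_ν ν} p_{ν̃ ν} = 0 holds if and only if α + β + γ + αβγ = 0, which in turn holds if and only if ℓ₀₂ = ℓ₀₁ ℓ₀₃. -/

import Mathlib

open Complex

/-- For distinct `μ ν`, `pr μ ν = (μ', ν')`, the unique pair with
`{μ', ν'} = {0,1,2,3} \ {μ, ν}` and `μ' > ν'` iff `μ > ν`; `pr μ μ = (μ, μ)`. -/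
def pr : Fin 4 → Fin 4 → Fin 4 × Fin 4 :=
  ![![(0,0),(2,3),(1,3),(1,2)],
    ![(3,2),(1,1),(0,3),(0,2)],
    ![(3,1),(3,0),(2,2),(0,1)],
    ![(2,1),(2,0),(1,0),(3,3)]]

/-- The table `ν ↦ (ν̃, μ_ν, μ̃_ν)`. -/
def tnu : Fin 4 → Fin 4 × Fin 4 × Fin 4 :=
  ![(1,2,3),(0,3,2),(3,0,1),(2,1,0)]

/-- The Sklyanin parameters `ℓ_{μν}`: `ℓ₀₁ = (1−α)/(1+α)`, `ℓ₀₂ = (1+β)/(1−β)`,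
`ℓ₀₃ = (1−γ)/(1+γ)`, extended by `ℓ_{μμ} = 1`, `ℓ_{μν} = ℓ_{νμ} = ℓ_{μ'ν'}`. -/
noncomputable def sklL (α β γ : ℂ) : Fin 4 → Fin 4 → ℂ :=
  ![![1, (1-α)/(1+α), (1+β)/(1-β), (1-γ)/(1+γ)],
    ![(1-α)/(1+α), 1, (1-γ)/(1+γ), (1+β)/(1-β)],
    ![(1+β)/(1-β), (1-γ)/(1+γ), 1, (1-α)/(1+α)],
    ![(1-γ)/(1+γ), (1+β)/(1-β), (1-α)/(1+α), 1]]

/-- The Sklyanin parameters `p_{μν}`: `p₀₁ = 2iα/(1+α)`, `p₂₃ = 2i/(1+α)`,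
`p₀₂ = 2iβ/(1−β)`, `p₁₃ = −2i/(1−β)`, `p₀₃ = 2iγ/(1+γ)`, `p₁₂ = 2i/(1+γ)`,
extended by `p_{μν} = −p_{νμ}`, `p_{μμ} = 0`. -/
noncomputable def sklP (α β γ : ℂ) : Fin 4 → Fin 4 → ℂ :=
  ![![0, 2*I*α/(1+α), 2*I*β/(1-β), 2*I*γ/(1+γ)],
    ![-(2*I*α/(1+α)), 0, 2*I/(1+γ), -(2*I)/(1-β)],
    ![-(2*I*β/(1-β)), -(2*I/(1+γ)), 0, 2*I/(1+α)],
    ![-(2*I*γ/(1+γ)), (2*I)/(1-β), -(2*I/(1+α)), 0]]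

/-- The centrality condition for each single `ν` is already equivalent to
`α + β + γ + αβγ = 0`. -/
theorem central_iff (α β γ : ℂ) (hα : α ≠ -1) (hβ : β ≠ 1) (hγ : γ ≠ -1) (ν : Fin 4) :
    sklP α β γ (tnu ν).2.1 ν + sklP α β γ (tnu ν).2.2 ν +
        sklL α β γ (tnu ν).2.2 ν * sklP α β γ (tnu ν).1 ν = 0 ↔
      α + β + γ + α * β * γ = 0 := by
  have ha : 1 + α ≠ 0 := fun h => hα (by linear_combination h)
  have hb : 1 - β ≠ 0 := fun h => hβ (by linear_combination -h)
  have hc : 1 + γ ≠ 0 := fun h => hγ (by linear_combination h)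
  have key : ∀ (x c : ℂ), c ≠ 0 →
      x = c * (2 * I / ((1 + α) * (1 - β) * (1 + γ))) * (α + β + γ + α * β * γ) →
      (x = 0 ↔ α + β + γ + α * β * γ = 0) := by
    intro x c hc0 hx
    have hd : c * (2 * I / ((1 + α) * (1 - β) * (1 + γ))) ≠ 0 := by
      exact mul_ne_zero hc0 (div_ne_zero (mul_ne_zero two_ne_zero I_ne_zero)
        (mul_ne_zero (mul_ne_zero ha hb) hc))
    rw [hx, mul_eq_zero, or_iff_right hd]
  fin_cases ν
  · apply key _ (-1) (by norm_num)
    simp [sklP, sklL, tnu]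
    field_simp
    ring
  · apply key _ 1 (by norm_num)
    simp [sklP, sklL, tnu]
    field_simp
    ring
  · apply key _ 1 (by norm_num)
    simp [sklP, sklL, tnu]
    field_simp
    ring
  · apply key _ (-1) (by norm_num)
    simp [sklP, sklL, tnu]
    field_simp
    ring

/-- the Sklyanin parameters satisfy `ℓ_{μν}² + p_{μν} p_{ν'μ'} = 1`;
the centrality condition `p_{μ_ν ν} + p_{μ̃_ν ν} + ℓ_{μ̃_ν ν} p_{ν̃ ν} = 0` (for all ν)
holds iff `α + β + γ + αβγ = 0`, which holds iff `ℓ₀₂ = ℓ₀₁ ℓ₀₃`. -/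
theorem stmt9 (α β γ : ℂ) (hα : α ≠ -1) (hβ : β ≠ 1) (hγ : γ ≠ -1) :
    (∀ μ ν : Fin 4,
      sklL α β γ μ ν ^ 2 +
        sklP α β γ μ ν * sklP α β γ (pr μ ν).2 (pr μ ν).1 = 1) ∧
    ((∀ ν : Fin 4,
      sklP α β γ (tnu ν).2.1 ν + sklP α β γ (tnu ν).2.2 ν +
        sklL α β γ (tnu ν).2.2 ν * sklP α β γ (tnu ν).1 ν = 0) ↔
        α + β + γ + α * β * γ = 0) ∧
    (α + β + γ + α * β * γ = 0 ↔
      sklL α β γ 0 2 = sklL α β γ 0 1 * sklL α β γ 0 3) := by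
  have ha : 1 + α ≠ 0 := fun h => hα (by linear_combination h)
  have hb : 1 - β ≠ 0 := fun h => hβ (by linear_combination -h)
  have hc : 1 + γ ≠ 0 := fun h => hγ (by linear_combination h)
  refine ⟨?_, ⟨fun h => (central_iff α β γ hα hβ hγ 0).1 (h 0),
    fun h ν => (central_iff α β γ hα hβ hγ ν).2 h⟩, ?_⟩
  · intro μ ν
    fin_cases μ <;> fin_cases ν <;> simp [sklP, sklL, pr] <;> field_simp <;>
      simp only [I_sq] <;> ring
  · simp only [sklL, Matrix.cons_val]
    rw [div_mul_div_comm, div_eq_div_iff hb (mul_ne_zero ha hc)]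
    constructor
    · intro h
      linear_combination 2 * h
    · intro h
      linear_combination h / 2
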